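/- Let k be an odd positive integer and let G be an odd unicycle graph (a finite simple connected graph with n vertices and n edges whose unique cycle has odd length, and which is not itself a cycle graph, i.e., some vertex has degree different from 2). If G induces a k-periodic Grover walk, then the girth of G satisfies g(G) ≤ k − 4. -/

import Mathlib

open Matrix SimpleGraph

/-- The Grover transfer matrix `U = U(G)` of a finite simple graph `G`, a `2m × 2m`
complex matrix indexed by the darts (symmetric arcs) of `G`.  For darts `e, f`,
`U e f = 2/deg(t(f)) - 1` if `f = e⁻¹`, `U e f = 2/deg(t(f))` if `t(f) = o(e)` and
`f ≠ e⁻¹`, and `U e f = 0` otherwise. -/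
noncomputable def groverMatrix {V : Type*} [Fintype V] [DecidableEq V]
    (G : SimpleGraph V) [DecidableRel G.Adj] : Matrix G.Dart G.Dart ℂ :=
  fun e f =>
    if f = e.symm then 2 / (G.degree f.snd : ℂ) - 1
    else if f.snd = e.fst then 2 / (G.degree f.snd : ℂ)
    else 0

/-- `G` induces a `k`-periodic Grover walk: `U ^ k = 1` and `U ^ j ≠ 1` for `1 ≤ j < k`. -/
def InducesPeriodicGroverWalk {V : Type*} [Fintype V] [DecidableEq V]
    (G : SimpleGraph V) [DecidableRel G.Adj] (k : ℕ) : Prop :=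
  groverMatrix G ^ k = 1 ∧ ∀ j : ℕ, 1 ≤ j → j < k → groverMatrix G ^ j ≠ 1

/-- The transition matrix of the isotropic random walk on `G`:
`T u v = 1/deg(u)` if `u ∼ v` and `0` otherwise. -/
noncomputable def transitionMatrix {V : Type*} [Fintype V]
    (G : SimpleGraph V) [DecidableRel G.Adj] : Matrix V V ℝ :=
  fun u v => if G.Adj u v then 1 / (G.degree u : ℝ) else 0

/-- An odd closed walk contains a cycle that is not longer. -/
lemma girth_le_of_odd_loop {V : Type*} (G : SimpleGraph V) {u : V} (w : G.Walk u u)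
    (hw : Odd w.length) : G.girth ≤ w.length := by
  classical
  let H : SimpleGraph V := SimpleGraph.fromEdgeSet {e | e ∈ w.edges}
  have hE : ∀ e ∈ w.edges, e ∈ H.edgeSet := by
    intro e he
    rw [SimpleGraph.edgeSet_fromEdgeSet]
    exact ⟨he, fun hd => G.not_isDiag_of_mem_edgeSet (w.edges_subset_edgeSet he) hd⟩
  have hHG : H ≤ G := by
    intro a b hab
    rw [SimpleGraph.fromEdgeSet_adj] at hab
    exact w.edges_subset_edgeSet hab.1
  have hna : ¬ H.IsAcyclic := by
    intro hac
    have h2 := SimpleGraph.two_colorable_iff_forall_loop_even.1 hac.colorable_two u (w.transfer H hE)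
    rw [SimpleGraph.Walk.length_transfer] at h2
    exact (Nat.not_even_iff_odd.2 hw) h2
  unfold SimpleGraph.IsAcyclic at hna
  push Not at hna
  obtain ⟨v, c, hc⟩ := hna
  have hsub : c.edges ⊆ w.edges := by
    intro e he
    have := c.edges_subset_edgeSet he
    rw [SimpleGraph.edgeSet_fromEdgeSet] at this
    exact this.1
  have hlen : c.length ≤ w.length := by
    rw [← c.length_edges, ← w.length_edges]
    exact (hc.edges_nodup.subperm hsub).length_le
  have hc' : (c.mapLe hHG).IsCycle := hc.mapLe hHG
  have := SimpleGraph.girth_le_length hc'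
  simp at this
  omega

/-- Real version of the Grover matrix. -/
noncomputable def gr {V : Type*} [Fintype V] [DecidableEq V]
    (G : SimpleGraph V) [DecidableRel G.Adj] : Matrix G.Dart G.Dart ℝ :=
  fun e f => (if f.snd = e.fst then 2 / (G.degree f.snd : ℝ) else 0) - (if f = e.symm then 1 else 0)

section
variable {V : Type*} [Fintype V] [DecidableEq V] (G : SimpleGraph V) [DecidableRel G.Adj]

lemma gr_map : groverMatrix G = Complex.ofRealHom.mapMatrix (gr G) := by
  ext e f
  simp only [groverMatrix, gr, RingHom.mapMatrix_apply, Matrix.map_apply]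
  by_cases h1 : f = e.symm
  · subst h1
    simp
  · by_cases h2 : f.snd = e.fst
    · simp [h1, h2]
    · simp [h1, h2]

lemma gr_pow {k : ℕ} (h : groverMatrix G ^ k = 1) : gr G ^ k = 1 := by
  rw [gr_map, ← map_pow, ← map_one (Complex.ofRealHom.mapMatrix)] at h
  ext e f
  have := congrFun (congrFun h e) f
  simp only [RingHom.mapMatrix_apply, Matrix.map_apply, Complex.ofRealHom_eq_coe] at this
  exact_mod_cast this

lemma gr_ne_zero {e f : G.Dart} (h : gr G e f ≠ 0) : f.snd = e.fst := by
  by_contra h2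
  apply h
  have h1 : f ≠ e.symm := by
    rintro rfl
    exact h2 rfl
  simp [gr, h1, h2]

lemma gr_orth : (gr G)ᵀ * gr G = 1 := by
  ext f f'
  have hd : (G.degree f.snd : ℝ) ≠ 0 := by
    have : 0 < G.degree f.snd := (G.degree_pos_iff_exists_adj _).2 ⟨_, f.adj.symm⟩
    positivity
  have hcard := G.dart_fst_fiber_card_eq_degree f.snd
  have hdeg : f'.snd = f.snd → (G.degree f'.snd : ℝ) = G.degree f.snd := by
    intro h4
    rw [h4]
  have key : ∀ e : G.Dart, gr G e f * gr G e f' =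
      (if e.fst = f.snd then (if f'.snd = f.snd then 2 / (G.degree f.snd : ℝ) * (2 / (G.degree f.snd : ℝ)) else 0) else 0)
      - (if e = f.symm then (if f'.snd = f.snd then 2 / (G.degree f.snd : ℝ) else 0) else 0)
      - (if e = f'.symm then (if f'.snd = f.snd then 2 / (G.degree f.snd : ℝ) else 0) else 0)
      + (if e = f.symm then (if f = f' then 1 else 0) else 0) := by
    intro e
    have s1 : (f = e.symm) ↔ (e = f.symm) := by
      constructor <;> (rintro rfl; simp)
    have s2 : (f' = e.symm) ↔ (e = f'.symm) := by
      constructor <;> (rintro rfl; simp)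
    unfold gr
    rw [if_congr s1 rfl rfl, if_congr s2 rfl rfl]
    by_cases h1 : e = f.symm
    · subst h1
      by_cases h3 : f = f'
      · subst h3
        simp
        ring
      · have : f.symm ≠ f'.symm := fun h => h3 (by simpa using congrArg SimpleGraph.Dart.symm h)
        by_cases h4 : f'.snd = f.snd
        · simp [h3, this, h4, hdeg h4]
          ring
        · simp [h3, this, h4]
    · by_cases h2 : e = f'.symm
      · subst h2
        by_cases h4 : f'.snd = f.snd
        · simp [h1, h4, hdeg h4]
          ring
        · simp [h1, h4, Ne.symm h4]
      · by_cases h4 : f'.snd = f.snd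
        · by_cases h5 : e.fst = f.snd
          · simp [h1, h2, h4, h5, hdeg h4]
          · simp [h1, h2, h4, h5, Ne.symm h5]
        · by_cases h5 : e.fst = f.snd
          · simp [h1, h2, h4, h5]
          · simp [h1, h2, h4, h5, Ne.symm h5]
  rw [Matrix.mul_apply]
  simp only [Matrix.transpose_apply]
  rw [Finset.sum_congr rfl (fun e _ => key e)]
  simp only [Finset.sum_add_distrib, Finset.sum_sub_distrib, Finset.sum_ite_eq', Finset.mem_univ, if_true]
  rw [← Finset.sum_filter, Finset.sum_const, hcard, Matrix.one_apply]
  by_cases h4 : f'.snd = f.snd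
  · simp only [h4, if_true, nsmul_eq_mul]
    field_simp
    ring
  · simp [h4]

lemma gr_orth_pow (j : ℕ) : (gr G ^ j)ᵀ * gr G ^ j = 1 := by
  induction j with
  | zero => simp
  | succ j ih =>
    rw [pow_succ, Matrix.transpose_mul, Matrix.mul_assoc, ← Matrix.mul_assoc _ (gr G ^ j), ih,
      Matrix.one_mul, gr_orth]

/-- A nonzero entry of a power gives a walk between initial vertices. -/
lemma walk_fst (j : ℕ) : ∀ a b : G.Dart, (gr G ^ j) b a ≠ 0 →
    ∃ w : G.Walk a.fst b.fst, w.length = j := by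
  induction j with
  | zero =>
    intro a b h
    have : b = a := by
      by_contra hne
      exact h (by simp [hne])
    subst this
    exact ⟨.nil, rfl⟩
  | succ j ih =>
    intro a b h
    rw [pow_succ, Matrix.mul_apply] at h
    obtain ⟨c, -, hc⟩ := Finset.exists_ne_zero_of_sum_ne_zero h
    obtain ⟨w, hw⟩ := ih c b (left_ne_zero_of_mul hc)
    have hca := gr_ne_zero G (right_ne_zero_of_mul hc)
    have hadj : G.Adj a.fst c.fst := hca ▸ a.adj
    exact ⟨.cons hadj w, by simp [hw]⟩

lemma walk_snd_fst (j : ℕ) (a b : G.Dart) (h : (gr G ^ (j + 1)) b a ≠ 0) :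
    ∃ w : G.Walk a.snd b.fst, w.length = j := by
  rw [pow_succ, Matrix.mul_apply] at h
  obtain ⟨c, -, hc⟩ := Finset.exists_ne_zero_of_sum_ne_zero h
  obtain ⟨w, hw⟩ := walk_fst G j c b (left_ne_zero_of_mul hc)
  have hca := gr_ne_zero G (right_ne_zero_of_mul hc)
  exact ⟨w.copy hca.symm rfl, by simp [hw]⟩

lemma walk_snd (j : ℕ) (a b : G.Dart) (h : (gr G ^ j) b a ≠ 0) :
    ∃ w : G.Walk a.snd b.snd, w.length = j := by
  cases j with
  | zero =>
    have : b = a := by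
      by_contra hne
      exact h (by simp [hne])
    subst this
    exact ⟨.nil, rfl⟩
  | succ j =>
    obtain ⟨w, hw⟩ := walk_snd_fst G j a b h
    exact ⟨w.append (.cons b.adj .nil), by simp [hw]⟩

/-- Orthogonality bounds the sum of entries. -/
lemma sum_le (j : ℕ) (A B : Finset G.Dart) :
    2 * ∑ b ∈ B, ∑ a ∈ A, (gr G ^ j) b a ≤ (A.card : ℝ) + B.card := by
  set M := gr G ^ j with hM
  let x : G.Dart → ℝ := fun a => if a ∈ A then 1 else 0
  let y : G.Dart → ℝ := fun a => if a ∈ B then 1 else 0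
  have hS : ∑ b ∈ B, ∑ a ∈ A, M b a = y ⬝ᵥ (M *ᵥ x) := by
    simp [x, y, dotProduct, Matrix.mulVec]
  have hx : (M *ᵥ x) ⬝ᵥ (M *ᵥ x) = A.card := by
    rw [Matrix.dotProduct_mulVec, Matrix.vecMul_mulVec, gr_orth_pow, Matrix.vecMul_one]
    simp [x, dotProduct]
  have hy : y ⬝ᵥ y = B.card := by
    simp [y, dotProduct]
  have h0 : 0 ≤ (y - M *ᵥ x) ⬝ᵥ (y - M *ᵥ x) :=
    Finset.sum_nonneg fun i _ => mul_self_nonneg _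
  rw [sub_dotProduct, dotProduct_sub, dotProduct_sub, hx, hy, dotProduct_comm (M *ᵥ x) y, ← hS] at h0
  linarith

lemma exists_leaf (hG : G.Connected) (hm : G.edgeFinset.card = Fintype.card V)
    (hodd : ¬ G.Colorable 2) (hnotcycle : ∃ v : V, G.degree v ≠ 2) : ∃ l, G.degree l = 1 := by
  by_contra hno
  push Not at hno
  have hnt : Nontrivial V := by
    by_contra hn
    rw [not_nontrivial_iff_subsingleton] at hn
    exact hodd ⟨SimpleGraph.Coloring.mk (fun _ => 0) (fun {a b} hab => (hab.ne (Subsingleton.elim a b)).elim)⟩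
  have h2 : ∀ v, 2 ≤ G.degree v := by
    intro v
    have := hG.preconnected.degree_pos_of_nontrivial v
    have := hno v
    omega
  obtain ⟨v, hv⟩ := hnotcycle
  have hlt : ∑ _v : V, 2 < ∑ v, G.degree v :=
    Finset.sum_lt_sum (fun i _ => h2 i) ⟨v, Finset.mem_univ _, lt_of_le_of_ne (h2 v) (Ne.symm hv)⟩
  rw [G.sum_degrees_eq_twice_card_edges, hm] at hlt
  simp at hlt
  omega

/-- Key step: no short odd period. -/
lemma key_ne {j : ℕ} (hj : Even j) (e : G.Dart) (hl : G.degree e.fst = 1)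
    (hno : ∀ (u : V) (w : G.Walk u u), w.length + 1 ≠ j) :
    (gr G ^ (j + 3)) e e ≠ 1 := by
  have hleaf : ∀ x, G.Adj e.fst x → x = e.snd := by
    intro x hx
    obtain ⟨y, hy⟩ := Finset.card_eq_one.1 hl
    have h1 : x ∈ G.neighborFinset e.fst := by simpa using hx
    have h2 : e.snd ∈ G.neighborFinset e.fst := by simpa using e.adj
    rw [hy, Finset.mem_singleton] at h1 h2
    rw [h1, h2]
  -- no walks from the leaf to its neighbour of length `j`
  have hnw : ∀ w : G.Walk e.fst e.snd, w.length ≠ j := by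
    intro w hw
    generalize hu : e.snd = u at w
    cases w with
    | nil => exact e.adj.ne hu.symm
    | cons hadj p =>
      have := hleaf _ hadj
      rw [hu] at this
      subst this
      exact hno _ p (by simpa using hw)
  set M := gr G ^ j with hM
  set D : ℝ := (G.degree e.snd : ℝ) with hD
  let A : Finset G.Dart := Finset.univ.filter (fun a => a.fst = e.snd ∧ a ≠ e.symm)
  let B : Finset G.Dart := Finset.univ.filter (fun b => b.snd = e.snd ∧ b ≠ e)
  have hA : A.card + 1 = G.degree e.snd := by
    rw [← G.dart_fst_fiber_card_eq_degree e.snd]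
    have : A = (Finset.univ.filter (fun d : G.Dart => d.fst = e.snd)).erase e.symm := by
      ext a
      simp [A, and_comm]
    rw [this]
    exact Finset.card_erase_add_one (by simp)
  have hBA : B.card = A.card := by
    apply Finset.card_bij (fun b _ => b.symm)
    · intro b hb
      simp only [B, A, Finset.mem_filter, Finset.mem_univ, true_and] at hb ⊢
      exact ⟨hb.1, fun h => hb.2 (by simpa using congrArg SimpleGraph.Dart.symm h)⟩
    · intro a _ b _ h
      simpa using congrArg SimpleGraph.Dart.symm h
    · intro a ha
      simp only [B, A, Finset.mem_filter, Finset.mem_univ, true_and] at ha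
      refine ⟨a.symm, ?_, by simp⟩
      simp only [B, Finset.mem_filter, Finset.mem_univ, true_and]
      exact ⟨ha.1, fun h => ha.2 (by simpa using congrArg SimpleGraph.Dart.symm h)⟩
  have h1 : (gr G ^ (j + 3)) e e = (gr G * M * gr G) e.symm e := by
    have : gr G ^ (j + 3) = gr G * (gr G * M * gr G) := by
      rw [hM, ← pow_succ', ← pow_succ, ← pow_succ']
    rw [this, Matrix.mul_apply, Finset.sum_eq_single e.symm]
    · have : gr G e e.symm = 1 := by
        have hl' : (G.degree e.symm.snd : ℝ) = 1 := by
          exact_mod_cast hl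
        simp [gr, hl']
        norm_num
      rw [this, one_mul]
    · intro c _ hc
      have : gr G e c = 0 := by
        by_contra h0
        have h2 := gr_ne_zero G h0
        apply hc
        have h3 := hleaf c.fst (h2 ▸ c.adj.symm)
        ext
        · simpa using h3
        · simpa using h2
      rw [this, zero_mul]
    · simp
  have h2 : (gr G * M * gr G) e.symm e = (2 / D) * (2 / D) * ∑ b ∈ B, ∑ a ∈ A, M b a := by
    rw [Matrix.mul_assoc, Matrix.mul_apply]
    simp only [Matrix.mul_apply, Finset.mul_sum]
    rw [← Finset.sum_subset (Finset.subset_univ B)]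
    · apply Finset.sum_congr rfl
      intro b hb
      simp only [B, Finset.mem_filter, Finset.mem_univ, true_and] at hb
      have hb2 : gr G e.symm b = 2 / D := by
        have hdeg : (G.degree b.snd : ℝ) = D := by
          rw [hD, hb.1]
        simp [gr, hb.1, hb.2, hdeg]
      rw [← Finset.sum_subset (Finset.subset_univ A)]
      · apply Finset.sum_congr rfl
        intro a ha
        simp only [A, Finset.mem_filter, Finset.mem_univ, true_and] at ha
        have ha2 : gr G a e = 2 / D := by
          have : e ≠ a.symm := by
            intro h
            exact ha.2 (by rw [h]; simp)
          simp [gr, ha.1, this, hD]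
        rw [ha2, hb2]
        ring
      · intro a _ ha
        by_contra h0
        have ha1 := gr_ne_zero G (right_ne_zero_of_mul (right_ne_zero_of_mul h0))
        have hMba := left_ne_zero_of_mul (right_ne_zero_of_mul h0)
        have : a = e.symm := by
          by_contra hne
          exact ha (by simp [A, hne, ha1])
        subst this
        obtain ⟨w, hw⟩ := walk_snd G j _ _ hMba
        exact hnw (w.copy (u' := e.fst) rfl hb.1) ((w.length_copy _ _).trans hw)
    · intro b _ hb
      apply Finset.sum_eq_zero
      intro a _
      by_contra h0
      have hb1 : b.snd = e.snd := gr_ne_zero G (left_ne_zero_of_mul h0)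
      have ha1 := gr_ne_zero G (right_ne_zero_of_mul (right_ne_zero_of_mul h0))
      have hMba := left_ne_zero_of_mul (right_ne_zero_of_mul h0)
      have : b = e := by
        by_contra hne
        exact hb (by simp [B, hne, hb1])
      subst this
      obtain ⟨w, hw⟩ := walk_fst G j _ _ hMba
      exact hnw (w.reverse.copy rfl ha1.symm) (by simp [hw])
  rw [h1, h2]
  intro hone
  have hDA : D = A.card + 1 := by
    rw [hD, ← hA]
    push_cast
    ring
  have hDpos : 0 < D := by
    rw [hDA]
    positivity
  by_cases hc : A.card ≤ 1
  · have : ∑ b ∈ B, ∑ a ∈ A, M b a = 0 := by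
      apply Finset.sum_eq_zero
      intro b hb
      apply Finset.sum_eq_zero
      intro a ha
      have hbA : b.symm ∈ A := by
        simp only [B, A, Finset.mem_filter, Finset.mem_univ, true_and] at hb ⊢
        exact ⟨hb.1, fun h => hb.2 (by simpa using congrArg SimpleGraph.Dart.symm h)⟩
      have hab := Finset.card_le_one.1 hc _ ha _ hbA
      subst hab
      by_contra h0
      cases j with
      | zero =>
        have : b ≠ b.symm := fun h => b.adj.ne (congrArg (fun d : G.Dart => d.fst) h)
        exact h0 (by simp [hM, this])
      | succ i =>
        obtain ⟨w, hw⟩ := walk_snd_fst G i _ _ h0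
        exact hno _ w (congrArg (· + 1) hw)
    rw [this] at hone
    simp at hone
  · have hs := sum_le G j A B
    rw [← hM, hBA] at hs
    set S := ∑ b ∈ B, ∑ a ∈ A, M b a with hS
    have h3 : 4 * S = D ^ 2 := by
      field_simp at hone
      linarith
    have h4 : (2 : ℝ) ≤ A.card := by
      have : 2 ≤ A.card := by omega
      exact_mod_cast this
    nlinarith

end

theorem odd_unicycle_girth_le {V : Type*} [Fintype V] [DecidableEq V]
    (G : SimpleGraph V) [DecidableRel G.Adj] (hG : G.Connected)
    (hm : G.edgeFinset.card = Fintype.card V)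
    (hodd : ¬ G.Colorable 2)
    (hnotcycle : ∃ v : V, G.degree v ≠ 2)
    (k : ℕ) (hk : Odd k) (h : InducesPeriodicGroverWalk G k) :
    G.girth ≤ k - 4 := by
  obtain ⟨l, hl⟩ := exists_leaf G hG hm hodd hnotcycle
  obtain ⟨u, hu⟩ := (G.degree_pos_iff_exists_adj l).1 (by omega)
  let e : G.Dart := ⟨(l, u), hu⟩
  have hU := gr_pow G h.1
  by_contra hlt
  obtain ⟨t, rfl⟩ := hk
  rcases t with _ | t
  · have h1 := congrFun (congrFun hU e) e
    have h2 : gr G e e = 0 := by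
      by_contra h0
      exact hu.ne (gr_ne_zero G h0).symm
    simp [h2] at h1
  · refine key_ne G (j := 2 * t) (even_two_mul t) e hl ?_ ?_
    · intro v w hw
      have := girth_le_of_odd_loop G w ⟨t - 1, by omega⟩
      omega
    · have : 2 * (t + 1) + 1 = 2 * t + 3 := by ring
      rw [this] at hU
      rw [hU]
      simp
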